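/- arXiv:0812.2793 — 3 statements merged into one kernel-verified Lean document; each statement's English description precedes it below -/
import Mathlib

section
/- If a is a C^∞-smooth boundary point of a ℂ-convex domain D ⊆ ℂ^n, then the type m_a of a (the maximal order of contact of nontrivial analytic discs with ∂D at a) equals the line type l_a of a (the maximal order of contact of complex lines with ∂D at a). -/
open Complex Metric Set MeasureTheory

noncomputable section

/-- `ℂ^n` with the Euclidean (Hermitian) structure. -/
abbrev Cn (n : ℕ) := EuclideanSpace ℂ (Fin n)

instance (n : ℕ) : MeasurableSpace (Cn n) := borel _
instance (n : ℕ) : BorelSpace (Cn n) := ⟨rfl⟩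

/-- The complex affine line through `z` in direction `X`. -/
def cline {n : ℕ} (z X : Cn n) : Set (Cn n) := {w | ∃ l : ℂ, w = z + l • X}

/-- A domain: a nonempty connected open set. -/
def IsDomain' {n : ℕ} (D : Set (Cn n)) : Prop := IsOpen D ∧ IsConnected D

/-- `D` is ℂ-convex: its intersection with every complex affine line is, when
nonempty, connected and simply connected. -/
def IsCConvex {n : ℕ} (D : Set (Cn n)) : Prop :=
  ∀ z X : Cn n, X ≠ 0 → (D ∩ cline z X).Nonempty →
    IsConnected (D ∩ cline z X) ∧ SimplyConnectedSpace ↥(D ∩ cline z X)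

/-- The Carathéodory metric `γ_D(z;X)`. -/
def caraMetric {n : ℕ} (D : Set (Cn n)) (z X : Cn n) : ℝ :=
  sSup {r : ℝ | ∃ f : Cn n → ℂ, DifferentiableOn ℂ f D ∧ MapsTo f D (ball (0:ℂ) 1) ∧
    f z = 0 ∧ r = ‖fderiv ℂ f z X‖}

/-- The Kobayashi metric `κ_D(z;X)`. -/
def kobMetric {n : ℕ} (D : Set (Cn n)) (z X : Cn n) : ℝ :=
  sInf {a : ℝ | 0 ≤ a ∧ ∃ φ : ℂ → Cn n, DifferentiableOn ℂ φ (ball (0:ℂ) 1) ∧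
    MapsTo φ (ball (0:ℂ) 1) D ∧ φ 0 = z ∧ a • (fderiv ℂ φ 0 1) = X}

/-- The distance `d_D(z,X)` from `z` to `∂D` in direction `X`. -/
def dirDist {n : ℕ} (D : Set (Cn n)) (z X : Cn n) : ℝ :=
  sSup {r : ℝ | 0 < r ∧ ∀ l : ℂ, ‖l‖ < r → z + l • X ∈ D}

/-- The Euclidean distance `d_D(z)` from `z` to `∂D`. -/
def bdist {n : ℕ} (D : Set (Cn n)) (z : Cn n) : ℝ := Metric.infDist z (frontier D)

/-- `L_a`: the set of vectors `X` such that a disc `{a + λX : |λ| < ε}` lies in `∂D`. -/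
def La {n : ℕ} (D : Set (Cn n)) (a : Cn n) : Set (Cn n) :=
  {X | ∃ ε > (0:ℝ), ∀ l : ℂ, ‖l‖ < ε → a + l • X ∈ frontier D}

/-- `D` contains no complex affine line. -/
def NoComplexLine {n : ℕ} (D : Set (Cn n)) : Prop :=
  ¬ ∃ z X : Cn n, X ≠ 0 ∧ cline z X ⊆ D

/-- The Bergman kernel `K_D(z)` (restricted to the diagonal). -/
def bergmanKernel {n : ℕ} (D : Set (Cn n)) (z : Cn n) : ℝ :=
  sSup {r : ℝ | ∃ f : Cn n → ℂ, DifferentiableOn ℂ f D ∧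
    IntegrableOn (fun w => ‖f w‖ ^ 2) D ∧ (∫ w in D, ‖f w‖ ^ 2) ≤ 1 ∧ r = ‖f z‖ ^ 2}

/-- `M_D(z;X)`. -/
def bergmanM {n : ℕ} (D : Set (Cn n)) (z X : Cn n) : ℝ :=
  sSup {r : ℝ | ∃ f : Cn n → ℂ, DifferentiableOn ℂ f D ∧
    IntegrableOn (fun w => ‖f w‖ ^ 2) D ∧ (∫ w in D, ‖f w‖ ^ 2) = 1 ∧
    f z = 0 ∧ r = ‖fderiv ℂ f z X‖}

/-- The Bergman metric `B_D(z;X) = M_D(z;X)/√K_D(z)`. -/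
def bergmanMetric {n : ℕ} (D : Set (Cn n)) (z X : Cn n) : ℝ :=
  bergmanM D z X / Real.sqrt (bergmanKernel D z)

/-- `G` is weakly linearly convex: through every boundary point there is a complex
affine hyperplane missing `G`. -/
def WeaklyLinConvex {n : ℕ} (G : Set (Cn n)) : Prop :=
  ∀ a ∈ frontier G, ∃ ℓ : Cn n →L[ℂ] ℂ, ℓ ≠ 0 ∧ ∀ z ∈ G, ℓ z ≠ ℓ a

/-- `d_{j,D}(z)` from the minimal-distance construction: the distance from `z` to the
boundary of the slice of `D` by the affine subspace `z + span{v_i : i ≥ j}`. -/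
def sliceDist {n : ℕ} (D : Set (Cn n)) (z : Cn n) (v : Fin n → Cn n) (j : Fin n) : ℝ :=
  sSup {r : ℝ | 0 < r ∧
    ∀ w ∈ Submodule.span ℂ (v '' {i | j ≤ i}), ‖w‖ < r → z + w ∈ D}

/-- The data `(v j)` is an admissible output of the minimal-distance construction at `z`:
the directions are orthonormal and each `v j` realizes the distance `d_{j,D}(z)` to the
boundary of the corresponding slice. -/
def MinimalBasis {n : ℕ} (D : Set (Cn n)) (z : Cn n) (v : Fin n → Cn n) : Prop :=
  Orthonormal ℂ v ∧ ∀ j : Fin n, z + (sliceDist D z v j) • v j ∉ D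


/-- Order of vanishing at `0` of a function `f : ℂ → ℝ`, as an extended real
(`⊤` if all derivatives at `0` vanish). -/
def ordR (f : ℂ → ℝ) : ENNReal :=
  sInf {k : ENNReal | ∃ m : ℕ, k = m ∧ iteratedFDeriv ℝ m f 0 ≠ 0}

/-- Order of vanishing at `0` of a map `f : ℂ → ℂⁿ` (w.r.t. complex differentiation). -/
def ordV {n : ℕ} (f : ℂ → Cn n) : ENNReal :=
  sInf {k : ENNReal | ∃ m : ℕ, k = m ∧ iteratedDeriv m f 0 ≠ 0}

open Filter Topology Asymptotics in
/-- If the derivatives of order `< N` of a smooth map vanish at `0`, the map is `O(‖x‖ ^ N)`. -/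
theorem isBigO_pow_of_iteratedFDeriv_eq_zero {E : Type} [NormedAddCommGroup E] [NormedSpace ℝ E]
    (N : ℕ) : ∀ {F : Type} [NormedAddCommGroup F] [NormedSpace ℝ F] {f : E → F},
    ContDiffAt ℝ N f 0 → (∀ m < N, iteratedFDeriv ℝ m f 0 = 0) →
    f =O[𝓝 0] fun x => ‖x‖ ^ N := by
  induction N with
  | zero =>
    intro F _ _ f hf _
    simpa using hf.continuousAt.norm.isBoundedUnder_le
  | succ N ih =>
    intro F _ _ f hf h0
    have hf' : ContDiffAt ℝ N (fderiv ℝ f) 0 := hf.fderiv_right (by norm_cast)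
    have hb := ih hf' fun m hm => by
      rw [← norm_eq_zero, norm_iteratedFDeriv_fderiv, h0 (m + 1) (by lia), norm_zero]
    obtain ⟨C, hCpos, hC⟩ := hb.exists_pos
    have hC := hC.bound
    have hd : ∀ᶠ x in 𝓝 (0 : E), DifferentiableAt ℝ f x := by
      filter_upwards [(hf.of_le (m := 1) (by norm_cast; lia)).eventually (by simp)] with x hx
      exact hx.differentiableAt (by simp)
    obtain ⟨ε, hε, hball⟩ := Metric.eventually_nhds_iff_ball.1 (hC.and hd)
    have hf0 : f 0 = 0 := by
      have := h0 0 (by lia)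
      rw [← norm_eq_zero, norm_iteratedFDeriv_zero] at this
      simpa using this
    refine IsBigO.of_bound C ?_
    filter_upwards [Metric.ball_mem_nhds (0 : E) hε] with x hx
    have hsub : closedBall (0 : E) ‖x‖ ⊆ ball 0 ε := by
      intro y hy
      simp only [mem_closedBall, mem_ball, dist_zero_right] at hy hx ⊢
      exact hy.trans_lt hx
    have key := (convex_closedBall (0 : E) ‖x‖).norm_image_sub_le_of_norm_fderiv_le
      (f := f) (𝕜 := ℝ) (C := C * ‖x‖ ^ N) (x := 0) (y := x)
      (fun y hy => (hball y (hsub hy)).2) (fun y hy => by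
        refine (hball y (hsub hy)).1.trans ?_
        have hy' : ‖y‖ ≤ ‖x‖ := by simpa using hy
        simp only [norm_pow, norm_norm]
        gcongr) (by simp) (by simp)
    simpa [hf0, pow_succ, mul_assoc] using key

open Filter Topology Asymptotics in
/-- A Landau-type interpolation: if `f = o(‖x‖ ^ (j + 2))` and `D²f = O(‖x‖ ^ j)`, then
`Df = o(‖x‖ ^ (j + 1))`. -/
theorem isLittleO_fderiv_of_isBigO_fderiv_fderiv {E F : Type} [NormedAddCommGroup E]
    [NormedSpace ℝ E] [NormedAddCommGroup F] [NormedSpace ℝ F] {f : E → F} {j : ℕ}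
    (hf : ContDiffAt ℝ 2 f 0) (hfo : f =o[𝓝 0] fun x => ‖x‖ ^ (j + 2))
    (hD : fderiv ℝ (fderiv ℝ f) =O[𝓝 0] fun x => ‖x‖ ^ j) :
    fderiv ℝ f =o[𝓝 0] fun x => ‖x‖ ^ (j + 1) := by
  obtain ⟨C, hCpos, hC⟩ := hD.exists_pos
  have hC := hC.bound
  have hd : ∀ᶠ x in 𝓝 (0 : E), DifferentiableAt ℝ f x ∧ DifferentiableAt ℝ (fderiv ℝ f) x := by
    filter_upwards [hf.eventually (by simp)] with x hx
    exact ⟨hx.differentiableAt (by simp),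
      (hx.fderiv_right (m := 1) (by norm_num)).differentiableAt (by simp)⟩
  refine isLittleO_iff.2 fun c hc => ?_
  -- choose the step `t = e * ‖x‖`
  set e : ℝ := min 1 (c / (2 * (C * 2 ^ j))) with he
  have he0 : 0 < e := by positivity
  have he1 : e ≤ 1 := min_le_left _ _
  have heC : C * 2 ^ j * e ≤ c / 2 := by
    have : e ≤ c / (2 * (C * 2 ^ j)) := min_le_right _ _
    rw [le_div_iff₀ (by positivity)] at this
    linarith
  set b : ℝ := c * e / (2 * (2 ^ (j + 2) + 1)) with hb
  have hb0 : 0 < b := by positivity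
  obtain ⟨ε, hε, hball⟩ := Metric.eventually_nhds_iff_ball.1
    ((isLittleO_iff.1 hfo hb0).and (hC.and hd))
  filter_upwards [Metric.ball_mem_nhds (0 : E) (half_pos hε)] with x hx
  rcases eq_or_ne x 0 with rfl | hx0
  · have hz : HasFDerivAt f (0 : E →L[ℝ] F) 0 := by
      have h0 : f 0 = 0 := by
        have := (hball 0 (mem_ball_self hε)).1
        simpa using this
      rw [hasFDerivAt_iff_isLittleO_nhds_zero]
      simp only [zero_add, h0, sub_zero, _root_.zero_apply]
      refine hfo.trans_isBigO (IsBigO.of_bound 1 ?_)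
      filter_upwards [Metric.ball_mem_nhds (0 : E) one_pos] with y hy
      have hy1 : ‖y‖ ≤ 1 := by simpa using (mem_ball_zero_iff.1 hy).le
      simp only [norm_pow, norm_norm, one_mul]
      exact (pow_le_pow_of_le_one (norm_nonneg _) hy1 (by lia : 1 ≤ j + 2)).trans (by simp)
    simp [hz.fderiv]
  have hxp : 0 < ‖x‖ := norm_pos_iff.2 hx0
  have hx2 : ‖x‖ < ε / 2 := by simpa using hx
  have hsub : closedBall x (e * ‖x‖) ⊆ ball 0 ε := by
    intro y hy
    have h1 : ‖y - x‖ ≤ e * ‖x‖ := by simpa [dist_eq_norm] using hy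
    have h2 : ‖y‖ ≤ ‖y - x‖ + ‖x‖ := by simpa using norm_add_le (y - x) x
    rw [mem_ball_zero_iff]
    nlinarith
  have hnorm : ∀ y ∈ closedBall x (e * ‖x‖), ‖y‖ ≤ 2 * ‖x‖ := by
    intro y hy
    have h1 : ‖y - x‖ ≤ e * ‖x‖ := by simpa [dist_eq_norm] using hy
    have h2 : ‖y‖ ≤ ‖y - x‖ + ‖x‖ := by simpa using norm_add_le (y - x) x
    nlinarith
  have hxm : x ∈ closedBall x (e * ‖x‖) := mem_closedBall_self (by positivity)
  have hDD : ∀ y ∈ closedBall x (e * ‖x‖),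
      ‖fderiv ℝ f y - fderiv ℝ f x‖ ≤ C * (2 * ‖x‖) ^ j * (e * ‖x‖) := by
    intro y hy
    have := (convex_closedBall x (e * ‖x‖)).norm_image_sub_le_of_norm_fderiv_le
      (f := fderiv ℝ f) (𝕜 := ℝ) (C := C * (2 * ‖x‖) ^ j) (x := x) (y := y)
      (fun z hz => (hball z (hsub hz)).2.2.2) (fun z hz => by
        refine (hball z (hsub hz)).2.1.trans ?_
        simp only [norm_pow, norm_norm]
        have := hnorm z hz
        gcongr) hxm hy
    refine this.trans ?_
    have h1 : ‖y - x‖ ≤ e * ‖x‖ := by simpa [dist_eq_norm] using hy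
    gcongr
  refine ContinuousLinearMap.opNorm_le_of_unit_norm (by positivity) fun v hv => ?_
  set y := x + (e * ‖x‖) • v with hy
  have hyx : ‖y - x‖ = e * ‖x‖ := by
    rw [hy, add_sub_cancel_left, norm_smul, hv, mul_one, Real.norm_of_nonneg (by positivity)]
  have hym : y ∈ closedBall x (e * ‖x‖) := by simp [dist_eq_norm, hyx]
  have key := (convex_closedBall x (e * ‖x‖)).norm_image_sub_le_of_norm_fderiv_le'
    (f := f) (𝕜 := ℝ) (φ := fderiv ℝ f x) (x := x) (y := y)
    (fun z hz => (hball z (hsub hz)).2.2.1) hDD hxm hym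
  have hfx : ‖f x‖ ≤ b * ‖x‖ ^ (j + 2) := by simpa using (hball x (hsub hxm)).1
  have hfy : ‖f y‖ ≤ b * (2 ^ (j + 2) * ‖x‖ ^ (j + 2)) := by
    have h1 : ‖f y‖ ≤ b * ‖y‖ ^ (j + 2) := by simpa using (hball y (hsub hym)).1
    refine h1.trans ?_
    rw [← mul_pow]
    have := hnorm y hym
    gcongr
  rw [hyx] at key
  have hlin : fderiv ℝ f x (y - x) = (e * ‖x‖) • fderiv ℝ f x v := by
    rw [hy, add_sub_cancel_left, map_smul]
  have h3 : ‖fderiv ℝ f x (y - x)‖ = (e * ‖x‖) * ‖fderiv ℝ f x v‖ := by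
    rw [hlin, norm_smul, Real.norm_of_nonneg (by positivity)]
  have h4 : ‖fderiv ℝ f x (y - x)‖ ≤
      ‖f y‖ + ‖f x‖ + ‖f y - f x - fderiv ℝ f x (y - x)‖ := by
    have : fderiv ℝ f x (y - x) = f y - f x - (f y - f x - fderiv ℝ f x (y - x)) := by abel
    calc _ = ‖f y - f x - (f y - f x - fderiv ℝ f x (y - x))‖ := by rw [← this]
      _ ≤ _ := (norm_sub_le _ _).trans (by gcongr; exact norm_sub_le _ _)
  have h5 : (e * ‖x‖) * ‖fderiv ℝ f x v‖ ≤ (e * ‖x‖) * (c * ‖x‖ ^ (j + 1)) := by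
    rw [← h3]
    calc _ ≤ b * (2 ^ (j + 2) * ‖x‖ ^ (j + 2)) + b * ‖x‖ ^ (j + 2)
            + C * (2 * ‖x‖) ^ j * (e * ‖x‖) * (e * ‖x‖) := by
          linarith
      _ = c * e / 2 * ‖x‖ ^ (j + 2) + (C * 2 ^ j * e) * (e * ‖x‖ ^ (j + 2)) := by
          rw [hb]; field_simp; ring
      _ ≤ c * e / 2 * ‖x‖ ^ (j + 2) + (c / 2) * (e * ‖x‖ ^ (j + 2)) := by gcongr
      _ = _ := by ring
  simpa using le_of_mul_le_mul_left h5 (by positivity)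

open Filter Topology Asymptotics in
/-- A smooth map that is `o(‖x‖ ^ j)` at `0` has vanishing `j`-th derivative at `0`. -/
theorem iteratedFDeriv_eq_zero_of_isLittleO {E : Type} [NormedAddCommGroup E] [NormedSpace ℝ E]
    (j : ℕ) : ∀ {F : Type} [NormedAddCommGroup F] [NormedSpace ℝ F] {f : E → F},
    ContDiffAt ℝ j f 0 → (f =o[𝓝 0] fun x => ‖x‖ ^ j) → iteratedFDeriv ℝ j f 0 = 0 := by
  induction j using Nat.strong_induction_on with
  | _ j ih =>
    intro F _ _ f hf hfo
    rcases j with - | - | j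
    · have : Tendsto f (𝓝 0) (𝓝 0) := by simpa using hfo
      have h0 : f 0 = 0 := tendsto_nhds_unique hf.continuousAt.tendsto this
      rw [← norm_eq_zero, norm_iteratedFDeriv_zero, h0, norm_zero]
    · have h0 : f 0 = 0 := by
        obtain h := (isLittleO_iff.1 hfo one_pos).self_of_nhds
        simpa using h
      have hz : HasFDerivAt f (0 : E →L[ℝ] F) 0 := by
        rw [hasFDerivAt_iff_isLittleO_nhds_zero]
        simp only [zero_add, pow_one] at hfo
        simpa [h0] using hfo.of_norm_right
      rw [← norm_eq_zero, ← norm_iteratedFDeriv_fderiv, norm_iteratedFDeriv_zero, hz.fderiv,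
        norm_zero]
    · have hlow : ∀ i < j + 2, iteratedFDeriv ℝ i f 0 = 0 := fun i hi =>
        ih i hi (hf.of_le (by norm_cast; lia)) (hfo.trans_isBigO (IsBigO.of_bound 1 (by
          filter_upwards [Metric.ball_mem_nhds (0 : E) one_pos] with y hy
          have hy1 : ‖y‖ ≤ 1 := by simpa using (mem_ball_zero_iff.1 hy).le
          simpa using pow_le_pow_of_le_one (norm_nonneg _) hy1 (by lia : i ≤ j + 1 + 1))))
      have hf1 : ContDiffAt ℝ (j + 1 : ℕ) (fderiv ℝ f) 0 := hf.fderiv_right (by norm_cast)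
      have hf2 : ContDiffAt ℝ j (fderiv ℝ (fderiv ℝ f)) 0 := hf1.fderiv_right (by norm_cast)
      have hD := isBigO_pow_of_iteratedFDeriv_eq_zero j hf2 fun m hm => by
        rw [← norm_eq_zero, norm_iteratedFDeriv_fderiv, norm_iteratedFDeriv_fderiv,
          hlow (m + 1 + 1) (by lia), norm_zero]
      have h1 := isLittleO_fderiv_of_isBigO_fderiv_fderiv (hf.of_le (by norm_cast; lia)) hfo hD
      have h2 := ih (j + 1) (by lia) hf1 h1
      rw [← norm_eq_zero, ← norm_iteratedFDeriv_fderiv, h2, norm_zero]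

/-- A square root of a nowhere vanishing function on a family of simply connected plane domains,
normalized along a section, is jointly continuous. -/
theorem exists_continuousOn_sq_eq_of_family {P : Type*} [TopologicalSpace P] {E : Set (P × ℂ)}
    (hE : IsOpen E) (hs : ∀ x, IsSimplyConnected {m : ℂ | (x, m) ∈ E}) (h0 : ∀ x, (x, 0) ∈ E)
    {h : P × ℂ → ℂ} (hc : ContinuousOn h E) (hne : ∀ p ∈ E, h p ≠ 0) (h1 : ∀ x, h (x, 0) = 1) :
    ∃ s : P × ℂ → ℂ, ContinuousOn s E ∧ (∀ p ∈ E, s p ^ 2 = h p) ∧ ∀ x, s (x, 0) = 1 := by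
  have hslice : ∀ x, ∃ f : ℂ → ℂ, ContinuousOn f {m : ℂ | (x, m) ∈ E} ∧
      (∀ m, f m ^ 2 = h (x, m)) ∧ f 0 = 1 := by
    intro x
    have hcx : ContinuousOn (fun m : ℂ => h (x, m)) {m : ℂ | (x, m) ∈ E} :=
      hc.comp (by fun_prop) fun m hm => hm
    obtain ⟨f, hf, hf2⟩ := Complex.exists_continuousOn_pow_eq (hs x)
      (hE.preimage (by fun_prop : Continuous fun m : ℂ => (x, m))) hcx
      (by rintro ⟨m, hm, hm0⟩; exact hne _ hm hm0) two_ne_zero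
    have hf0 : f 0 ^ 2 = 1 := by rw [hf2, h1]
    rcases mul_self_eq_one_iff.1 ((sq _).symm.trans hf0) with hp | hp
    · exact ⟨f, hf, hf2, hp⟩
    · exact ⟨fun m => -f m, hf.neg, fun m => by rw [neg_sq, hf2], by simp [hp]⟩
  choose f hf hf2 hf0 using hslice
  refine ⟨fun p => f p.1 p.2, ?_, fun p _ => hf2 p.1 p.2, hf0⟩
  -- continuity at one point of a small disc in a slice propagates to the whole disc
  have hloc : ∀ x m, (x, m) ∈ E → ∃ B ∈ nhds m, m ∈ B ∧ ∀ m₁ ∈ B,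
      ContinuousAt (fun y => f y m₁) x → ∀ m₂ ∈ B,
        ContinuousAt (fun p : P × ℂ => f p.1 p.2) (x, m₂) := by
    intro x m hxm
    have hch : ContinuousAt h (x, m) := hc.continuousAt (hE.mem_nhds hxm)
    have hn0 := hne _ hxm
    have hev : ∀ᶠ p in nhds (x, m), p ∈ E ∧ ‖h p / h (x, m) - 1‖ < 1 := by
      refine Filter.Eventually.and (hE.mem_nhds hxm) ?_
      have : ContinuousAt (fun p => ‖h p / h (x, m) - 1‖) (x, m) :=
        ((hch.div_const _).sub continuousAt_const).norm
      exact this.eventually_lt continuousAt_const (by simp [hn0])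
    obtain ⟨V₀, hV₀, B₀, hB₀, hVB⟩ := mem_nhds_prod_iff.1 hev
    obtain ⟨V, hVV, hVo, hxV⟩ := mem_nhds_iff.1 hV₀
    obtain ⟨ε, hε, hball⟩ := Metric.mem_nhds_iff.1 hB₀
    have hmem : ∀ y ∈ V, ∀ w ∈ ball m ε, (y, w) ∈ E ∧ ‖h (y, w) / h (x, m) - 1‖ < 1 :=
      fun y hy w hw => hVB ⟨hVV hy, hball hw⟩
    refine ⟨ball m ε, ball_mem_nhds m hε, mem_ball_self hε, fun m₁ hm₁ hcm₁ m₂ hm₂ => ?_⟩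
    set c := f x m with hcdef
    have hc2 : c ^ 2 = h (x, m) := hf2 x m
    set q : P × ℂ → ℂ := fun p => c * (h p / h (x, m)) ^ (1 / 2 : ℂ) with hq
    have hq2 : ∀ p, q p ^ 2 = h p := by
      intro p
      have : ((h p / h (x, m)) ^ (1 / 2 : ℂ)) ^ 2 = h p / h (x, m) := by
        simp
      rw [hq]; simp only
      rw [mul_pow, this, hc2]
      field_simp
    have hqc : ∀ y ∈ V, ∀ w ∈ ball m ε, ContinuousAt q (y, w) := by
      intro y hy w hw
      obtain ⟨h₁, h₂⟩ := hmem y hy w hw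
      have hch' : ContinuousAt h (y, w) := hc.continuousAt (hE.mem_nhds h₁)
      refine continuousAt_const.mul ((hch'.div_const _).cpow continuousAt_const ?_)
      have := Complex.mem_slitPlane_of_norm_lt_one h₂
      simpa using this
    have hqne : ∀ y ∈ V, ∀ w ∈ ball m ε, q (y, w) ≠ 0 := by
      intro y hy w hw hz
      have := hq2 (y, w)
      rw [hz] at this
      exact hne _ (hmem y hy w hw).1 (by rw [← this]; simp)
    set e : P → ℂ := fun y => f y m₁ / q (y, m₁) with he
    have hec : ContinuousAt e x := by
      refine hcm₁.div ?_ (hqne x hxV m₁ hm₁)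
      exact ContinuousAt.comp' (f := fun y => (y, m₁)) (g := q) (hqc x hxV m₁ hm₁) (by fun_prop)
    have heq : ∀ y ∈ V, ∀ w ∈ ball m ε, f y w = e y * q (y, w) := by
      intro y hy
      have hqy1 := hqne y hy m₁ hm₁
      have he2 : e y ^ 2 = 1 := by
        rw [he]; simp only
        rw [div_pow, hf2, hq2, div_self (hne _ (hmem y hy m₁ hm₁).1)]
      have he0 : e y ≠ 0 := by
        intro hz; rw [hz] at he2; simp at he2
      refine (convex_ball m ε).isPreconnected.eq_of_sq_eq (𝕜 := ℂ) (f := f y)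
        (g := fun w => e y * q (y, w))
        ((hf y).mono fun w hw => (hmem y hy w hw).1) ?_ ?_ ?_ hm₁ ?_
      · intro w hw
        exact (continuousAt_const.mul (ContinuousAt.comp' (f := fun w => (y, w)) (g := q)
          (hqc y hy w hw) (by fun_prop))).continuousWithinAt
      · intro w hw
        simp only [Pi.pow_apply, mul_pow, he2, hf2, hq2, one_mul]
      · intro w hw
        exact mul_ne_zero he0 (hqne y hy w hw)
      · rw [he]; simp only
        rw [div_mul_cancel₀ _ hqy1]
    have hprod : ContinuousAt (fun p : P × ℂ => e p.1 * q p) (x, m₂) :=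
      (ContinuousAt.comp' (f := fun p : P × ℂ => p.1) (g := e) (x := (x, m₂)) hec
        (by fun_prop)).mul (hqc x hxV m₂ hm₂)
    refine hprod.congr ?_
    filter_upwards [prod_mem_nhds (hVo.mem_nhds hxV) (isOpen_ball.mem_nhds hm₂)] with p hp
    exact (heq p.1 hp.1 p.2 hp.2).symm
  rintro ⟨x, m⟩ hxm
  refine ContinuousAt.continuousWithinAt ?_
  have hcont1 : ∀ m', ContinuousAt (fun p : P × ℂ => f p.1 p.2) (x, m') →
      ContinuousAt (fun y => f y m') x := fun m' h' =>
    ContinuousAt.comp' (f := fun y => (y, m')) (g := fun p : P × ℂ => f p.1 p.2) h' (by fun_prop)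
  have hstart : ContinuousAt (fun p : P × ℂ => f p.1 p.2) (x, 0) := by
    obtain ⟨B, -, h0B, hB⟩ := hloc x 0 (h0 x)
    refine hB 0 h0B ?_ 0 h0B
    simp only [hf0]
    exact continuousAt_const
  have hpre : IsPreconnected {m : ℂ | (x, m) ∈ E} :=
    (hs x).isPathConnected.isConnected.isPreconnected
  have := hpre.induction₂
    (fun a b => ContinuousAt (fun p : P × ℂ => f p.1 p.2) (x, a) ↔
      ContinuousAt (fun p : P × ℂ => f p.1 p.2) (x, b)) (fun a ha => by
      obtain ⟨B, hBn, haB, hB⟩ := hloc x a ha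
      filter_upwards [mem_nhdsWithin_of_mem_nhds hBn] with b hb
      exact ⟨fun hh => hB a haB (hcont1 a hh) b hb, fun hh => hB b hb (hcont1 b hh) a haB⟩)
    (fun _ _ _ _ _ _ h₁ h₂ => h₁.trans h₂) (fun _ _ _ _ h₁ => h₁.symm) (h0 x) hxm
  exact this.1 hstart

theorem IsCConvex.isSimplyConnected_slice {n : ℕ} {D : Set (Cn n)} (hcc : IsCConvex D)
    {z X : Cn n} {m : ℂ} (hm : z + m • X ∈ D) : IsSimplyConnected {l : ℂ | z + l • X ∈ D} := by
  rcases eq_or_ne X 0 with rfl | hX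
  · have : {l : ℂ | z + l • (0 : Cn n) ∈ D} = univ := by
      simp only [smul_zero, add_zero] at hm ⊢
      exact eq_univ_of_forall fun _ => hm
    rw [this]
    exact (Homeomorph.Set.univ ℂ).toHomotopyEquiv.simplyConnectedSpace
  · have h := (hcc z X hX ⟨_, hm, m, rfl⟩).2
    have hemb : Topology.IsEmbedding fun l : ℂ => z + l • X :=
      (Homeomorph.addLeft z).isEmbedding.comp
        (isClosedEmbedding_smul_left hX).isEmbedding
    have himg : (fun l : ℂ => z + l • X) '' {l : ℂ | z + l • X ∈ D} = D ∩ cline z X := by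
      ext w
      constructor
      · rintro ⟨l, hl, rfl⟩
        exact ⟨hl, l, rfl⟩
      · rintro ⟨hw, l, rfl⟩
        exact ⟨l, hw, rfl⟩
    rw [← hemb.isSimplyConnected_image, himg]
    exact h

/-- On a ℂ-convex open set, nowhere vanishing continuous functions have square roots. -/
theorem IsCConvex.exists_continuousOn_sq_eq {n : ℕ} {D : Set (Cn n)} (hcc : IsCConvex D)
    (hDo : IsOpen D) {H : Cn n → ℂ} (hc : ContinuousOn H D) (hne : ∀ z ∈ D, H z ≠ 0) {o : Cn n}
    (ho : o ∈ D) (h1 : H o = 1) :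
    ∃ S : Cn n → ℂ, ContinuousOn S D ∧ (∀ z ∈ D, S z ^ 2 = H z) ∧ S o = 1 := by
  have hg : Continuous fun p : Cn n × ℂ => o + p.2 • (p.1 - o) := by fun_prop
  have hslice : ∀ x, IsSimplyConnected {l : ℂ | o + l • (x - o) ∈ D} := fun x =>
    hcc.isSimplyConnected_slice (m := 0) (by simpa using ho)
  obtain ⟨s, hs, hs2, -⟩ := exists_continuousOn_sq_eq_of_family
    (P := Cn n) (E := {p : Cn n × ℂ | o + p.2 • (p.1 - o) ∈ D})
    (h := fun p => H (o + p.2 • (p.1 - o))) (hDo.preimage hg)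
    hslice (fun x => by simpa using ho)
    (hc.comp hg.continuousOn fun _ hp => hp) (fun p hp => hne _ hp) (fun x => by simp [h1])
  have hS : ContinuousOn (fun z => s (z, 1)) D :=
    hs.comp (f := fun z => (z, (1 : ℂ))) (by fun_prop) fun z hz => by simpa using hz
  have hS2 : ∀ z ∈ D, s (z, 1) ^ 2 = H z := fun z hz => by
    rw [hs2 (z, 1) (by simpa using hz)]
    simp
  rcases mul_self_eq_one_iff.1 ((sq _).symm.trans ((hS2 o ho).trans h1)) with hp | hp
  · exact ⟨fun z => s (z, 1), hS, hS2, hp⟩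
  · exact ⟨fun z => -s (z, 1), hS.neg, fun z hz => by rw [neg_sq, hS2 z hz], by simp [hp]⟩

/-- A complex tangent line through a boundary point of a ℂ-convex domain misses the domain. -/
theorem IsCConvex.add_notMem_of_tangent {n : ℕ} {D : Set (Cn n)} (hcc : IsCConvex D)
    (hDo : IsOpen D) {p : Cn n} (hp : p ∉ D) {r : Cn n → ℝ} {L : Cn n →L[ℝ] ℝ}
    (hr : HasFDerivAt r L p) (hrp : r p = 0) (hrD : ∀ᶠ z in nhds p, r z < 0 → z ∈ D) (hL : L ≠ 0)
    {Y : Cn n} (hY : ∀ κ : ℂ, L (κ • Y) = 0) : p + Y ∉ D := by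
  intro hYD
  obtain ⟨ν, hν⟩ : ∃ ν, 0 < L ν := by
    obtain ⟨v, hv⟩ := DFunLike.ne_iff.1 hL
    rcases lt_or_gt_of_ne hv with h | h
    · exact ⟨-v, by rw [map_neg]; simpa using h⟩
    · exact ⟨v, by simpa using h⟩
  obtain ⟨R, hR, hRD⟩ : ∃ R > (0 : ℝ), ∀ κ : ℂ, ‖κ‖ = R → p + κ⁻¹ • ν + Y ∈ D := by
    have hc : Continuous fun η : ℂ => p + η • ν + Y := by fun_prop
    obtain ⟨ε, hε, hball⟩ := Metric.isOpen_iff.1 (hDo.preimage hc) 0 (by simpa using hYD)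
    refine ⟨2 / ε, by positivity, fun κ hκ => hball ?_⟩
    rw [mem_ball_zero_iff, norm_inv, hκ, inv_div]
    linarith
  obtain ⟨t, ht, htD⟩ : ∃ t > (0 : ℝ), ∀ κ : ℂ, ‖κ‖ = R →
      p - (t : ℂ) • (ν + κ • Y) ∈ D := by
    set M := ‖ν‖ + R * ‖Y‖ with hM
    have hM0 : 0 ≤ M := by positivity
    have hev := (hr.isLittleO.def (c := L ν / (2 * (M + 1))) (by positivity)).and hrD
    obtain ⟨δ, hδ, hball⟩ := Metric.eventually_nhds_iff.1 hev
    have ht : 0 < δ / (2 * (M + 1)) := by positivity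
    refine ⟨δ / (2 * (M + 1)), ht, fun κ hκ => ?_⟩
    set t := δ / (2 * (M + 1)) with ht'
    have hV : ‖ν + κ • Y‖ ≤ M := by
      refine (norm_add_le _ _).trans ?_
      rw [norm_smul, hκ]
    have hn : ‖(p - (t : ℂ) • (ν + κ • Y)) - p‖ ≤ t * M := by
      rw [sub_sub_cancel_left, norm_neg, norm_smul, Complex.norm_real, Real.norm_of_nonneg ht.le]
      gcongr
    have htM : t * M < δ := by
      rw [ht', div_mul_eq_mul_div, div_lt_iff₀ (by positivity)]
      nlinarith
    obtain ⟨h1, h2⟩ := hball (y := p - (t : ℂ) • (ν + κ • Y)) (by rw [dist_eq_norm]; linarith)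
    apply h2
    have hLV : L (p - (t : ℂ) • (ν + κ • Y) - p) = -(t * L ν) := by
      rw [sub_sub_cancel_left, map_neg, Complex.coe_smul, map_smul, map_add, hY, add_zero,
        smul_eq_mul]
    rw [hrp, hLV, sub_zero, Real.norm_eq_abs] at h1
    have h3 := (le_abs_self _).trans (h1.trans (mul_le_mul_of_nonneg_left hn (by positivity)))
    have h4 : L ν / (2 * (M + 1)) * (t * M) ≤ t * L ν / 2 := by
      rw [div_mul_eq_mul_div, div_le_div_iff₀ (by positivity) (by positivity)]
      nlinarith [mul_pos ht hν]
    nlinarith [mul_pos ht hν]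
  have htC : (t : ℂ) ≠ 0 := by exact_mod_cast ht.ne'
  have hκ0 : ∀ κ : sphere (0 : ℂ) R, (κ : ℂ) ≠ 0 := fun κ => by
    rw [← norm_ne_zero_iff, mem_sphere_zero_iff_norm.1 κ.2]
    exact hR.ne'
  have hg : Continuous fun x : sphere (0 : ℂ) R × ℂ =>
      p - (t : ℂ) • (ν + (x.1 : ℂ) • Y) + x.2 • (ν + (x.1 : ℂ) • Y) := by fun_prop
  have h0 : ∀ κ : sphere (0 : ℂ) R, p - (t : ℂ) • (ν + (κ : ℂ) • Y) +
      (0 : ℂ) • (ν + (κ : ℂ) • Y) ∈ D := fun κ => by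
    rw [zero_smul, add_zero]
    exact htD κ (mem_sphere_zero_iff_norm.1 κ.2)
  have hslice : ∀ κ : sphere (0 : ℂ) R, IsSimplyConnected
      {l : ℂ | p - (t : ℂ) • (ν + (κ : ℂ) • Y) + l • (ν + (κ : ℂ) • Y) ∈ D} := fun κ =>
    hcc.isSimplyConnected_slice (h0 κ)
  obtain ⟨s, hs, hs2, -⟩ := exists_continuousOn_sq_eq_of_family
    (P := sphere (0 : ℂ) R) (E := {x : sphere (0 : ℂ) R × ℂ |
      p - (t : ℂ) • (ν + (x.1 : ℂ) • Y) + x.2 • (ν + (x.1 : ℂ) • Y) ∈ D})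
    (h := fun x => 1 - x.2 / t) (hDo.preimage hg) hslice h0 (by fun_prop)
    (fun x hx h => by
      have h2 : x.2 = t := by
        rw [sub_eq_zero, eq_div_iff htC, one_mul] at h
        exact h.symm
      apply hp
      have h3 : p - (t : ℂ) • (ν + (x.1 : ℂ) • Y) + x.2 • (ν + (x.1 : ℂ) • Y) ∈ D := hx
      rwa [h2, sub_add_cancel] at h3)
    (fun x => by simp)
  have hmem : ∀ κ : sphere (0 : ℂ) R, (κ, (t : ℂ) + (κ : ℂ)⁻¹) ∈ {x : sphere (0 : ℂ) R × ℂ |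
      p - (t : ℂ) • (ν + (x.1 : ℂ) • Y) + x.2 • (ν + (x.1 : ℂ) • Y) ∈ D} := fun κ => by
    have h := hRD κ (mem_sphere_zero_iff_norm.1 κ.2)
    have he : p - (t : ℂ) • (ν + (κ : ℂ) • Y) + ((t : ℂ) + (κ : ℂ)⁻¹) • (ν + (κ : ℂ) • Y) =
        p + (κ : ℂ)⁻¹ • ν + Y := by
      rw [add_smul, ← add_assoc, sub_add_cancel, smul_add, smul_smul, inv_mul_cancel₀ (hκ0 κ),
        one_smul, add_assoc]
    rw [mem_ofPred_eq, he]
    exact h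
  set c : ℝ → sphere (0 : ℂ) R := fun θ => ⟨circleMap 0 R θ, circleMap_mem_sphere 0 hR.le θ⟩
    with hc
  have hcc' : Continuous c := (continuous_circleMap 0 R).subtype_mk _
  set G : ℝ → ℂ := fun θ => s (c θ, t + (c θ : ℂ)⁻¹) * exp (θ / 2 * I) with hG
  have hGc : Continuous G := by
    refine Continuous.mul ?_ (by fun_prop)
    refine hs.comp_continuous (f := fun θ => (c θ, (t : ℂ) + (c θ : ℂ)⁻¹)) ?_ fun θ => hmem _
    have : Continuous fun θ => (c θ : ℂ)⁻¹ :=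
      (continuous_subtype_val.comp hcc').inv₀ fun θ => hκ0 _
    fun_prop
  have hG2 : ∀ θ, G θ ^ 2 = -1 / (t * R) := fun θ => by
    have hRC : (R : ℂ) ≠ 0 := by exact_mod_cast hR.ne'
    have hcθ : (c θ : ℂ) = R * exp (θ * I) := by simp [hc, circleMap]
    have he : exp (θ / 2 * I) ^ 2 = exp (θ * I) := by
      rw [← Complex.exp_nat_mul]
      congr 1
      push_cast
      ring
    rw [hG]
    simp only
    rw [mul_pow, hs2 _ (hmem _), he]
    simp only
    rw [hcθ]
    have := Complex.exp_ne_zero (θ * I)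
    field_simp
    ring
  have hGne : ∀ θ, G θ ≠ 0 := fun θ h => by
    have := hG2 θ
    rw [h] at this
    have hRC : (R : ℂ) ≠ 0 := by exact_mod_cast hR.ne'
    field_simp at this
    norm_num at this
  have hconst : G (2 * Real.pi) = G 0 :=
    isPreconnected_univ.eq_of_sq_eq (𝕜 := ℂ) (f := G) (g := fun _ => G 0) hGc.continuousOn
      continuousOn_const (fun θ _ => by simp only [Pi.pow_apply, hG2]) (fun _ => hGne 0)
      (mem_univ 0) rfl (mem_univ _)
  have hper : c (2 * Real.pi) = c 0 := by
    rw [hc]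
    exact Subtype.ext (by simpa using periodic_circleMap 0 R 0)
  have hneg : G (2 * Real.pi) = -G 0 := by
    simp only [hG, hper]
    have : ((2 * Real.pi : ℝ) : ℂ) / 2 * I = Real.pi * I := by push_cast; ring
    rw [this, Complex.exp_pi_mul_I]
    simp
  exact hGne 0 (self_eq_neg.1 (hconst.symm.trans hneg))

/-- A continuous square root of a nowhere vanishing holomorphic function is holomorphic. -/
theorem differentiableOn_of_continuousOn_of_sq_eq {V : Set ℂ} (hV : IsOpen V) {f g : ℂ → ℂ}
    (hf : DifferentiableOn ℂ f V) (hg : ContinuousOn g V) (hgf : ∀ z ∈ V, g z ^ 2 = f z)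
    (hf0 : ∀ z ∈ V, f z ≠ 0) : DifferentiableOn ℂ g V := by
  intro z hz
  have hg0 : g z ≠ 0 := fun h => hf0 z hz (by rw [← hgf z hz, h]; simp)
  have hgz : ContinuousAt (fun y => (g y / g z).re) z :=
    Complex.continuous_re.continuousAt.comp ((hg.continuousAt (hV.mem_nhds hz)).div_const _)
  have hpos : ∀ᶠ y in nhds z, 0 < (g y / g z).re :=
    continuousAt_const.eventually_lt hgz (by simp [hg0])
  have hd : DifferentiableAt ℂ (fun y => g z * (f y / f z) ^ (2⁻¹ : ℂ)) z := by
    refine (((hf.differentiableAt (hV.mem_nhds hz)).div_const _).cpow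
      (differentiableAt_const _) ?_).const_mul _
    rw [div_self (hf0 z hz)]
    exact Complex.one_mem_slitPlane
  refine (hd.congr_of_eventuallyEq ?_).differentiableWithinAt
  filter_upwards [hpos, hV.mem_nhds hz] with y hy hyV
  rw [← hgf y hyV, ← hgf z hz, ← div_pow, Complex.sq_cpow_two_inv hy, mul_div_cancel₀ _ hg0]

/-- Suppose a hyperplane through `p = o + c • X` misses the ℂ-convex open set `D`, while the disc
of radius `‖c‖` about `o` in direction `X` lies in `D`. Then the normalized square root of the
defining function of the hyperplane stays away from `-1` on `D`. -/
theorem IsCConvex.exists_sqrt_norm_add_one_ge {n : ℕ} {D : Set (Cn n)} (hcc : IsCConvex D)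
    (hDo : IsOpen D) {o X : Cn n} (ho : o ∈ D) {c : ℂ} {l : Cn n →L[ℂ] ℂ}
    (hl : ∀ z ∈ D, l (z - (o + c • X)) ≠ 0) (hdisc : ∀ m : ℂ, ‖m‖ < ‖c‖ → o + m • X ∈ D) :
    ∃ S : Cn n → ℂ, ContinuousOn S D ∧
      (∀ z ∈ D, S z ^ 2 = l (z - (o + c • X)) / l (o - (o + c • X))) ∧ S o = 1 ∧
      ∀ z ∈ D, 1 / 4 ≤ ‖1 + S z‖ := by
  have hlo := hl o ho
  have hloX : l (o - (o + c • X)) = -(c * l X) := by simp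
  have hH : ContinuousOn (fun z => l (z - (o + c • X)) / l (o - (o + c • X))) D := by fun_prop
  obtain ⟨S, hS, hS2, hSo⟩ := hcc.exists_continuousOn_sq_eq hDo hH
    (fun z hz => div_ne_zero (hl z hz) hlo) ho (div_self hlo)
  refine ⟨S, hS, hS2, hSo, fun z hz => ?_⟩
  by_contra! hlt
  have hne : ∀ z ∈ D, S z ≠ 0 := fun z hz h => by
    have := hS2 z hz
    rw [h] at this
    exact div_ne_zero (hl z hz) hlo (by rw [← this]; simp)
  have hc0 : 0 < ‖c‖ := by
    rw [norm_pos_iff]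
    rintro rfl
    simp at hloX hlo
  have hv : ∀ v ∈ ball (1 : ℂ) (1 / 4), o + (c * (1 - v ^ 2)) • X ∈ D := fun v hv => by
    apply hdisc
    rw [mem_ball, dist_eq_norm] at hv
    have h1 : ‖1 - v ^ 2‖ < 1 := by
      have h2 : ‖v + 1‖ ≤ 1 / 4 + 2 := by
        have : v + 1 = (v - 1) + 2 := by ring
        rw [this]
        refine (norm_add_le _ _).trans ?_
        rw [Complex.norm_ofNat]
        linarith
      have h3 : 1 - v ^ 2 = -((v - 1) * (v + 1)) := by ring
      rw [h3, norm_neg, norm_mul]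
      nlinarith [norm_nonneg (v - 1), norm_nonneg (v + 1)]
    rw [norm_mul]
    nlinarith
  have hv0 : ∀ v ∈ ball (1 : ℂ) (1 / 4), v ≠ 0 := by
    rintro v hv rfl
    norm_num at hv
  have hSv : ∀ v ∈ ball (1 : ℂ) (1 / 4), S (o + (c * (1 - v ^ 2)) • X) = v := by
    intro v hvb
    refine (convex_ball (1 : ℂ) (1 / 4)).isPreconnected.eq_of_sq_eq (𝕜 := ℂ)
      (f := fun v => S (o + (c * (1 - v ^ 2)) • X)) (g := fun v => v)
      (hS.comp (by fun_prop) hv) continuousOn_id ?_ (fun {v} h => hv0 v h)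
      (mem_ball_self (by norm_num)) ?_ hvb
    · intro v hvb
      simp only [Pi.pow_apply]
      rw [hS2 _ (hv v hvb), hloX]
      have : l (o + (c * (1 - v ^ 2)) • X - (o + c • X)) = -(c * l X) * v ^ 2 := by
        simp only [map_sub, map_add, map_smul, smul_eq_mul]
        ring
      rw [this, mul_div_cancel_left₀ _ (by rwa [← hloX])]
    · simpa using hSo
  have hvz : -S z ∈ ball (1 : ℂ) (1 / 4) := by
    rw [mem_ball, dist_eq_norm, ← norm_neg]
    rwa [neg_sub, sub_neg_eq_add]
  set z' := o + (c * (1 - (-S z) ^ 2)) • X with hz'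
  have hz'D : z' ∈ D := hv _ hvz
  have hSz' : S z' = -S z := hSv _ hvz
  have hll : l (z' - z) = 0 := by
    have h1 : S z' ^ 2 = S z ^ 2 := by rw [hSz', neg_sq]
    rw [hS2 _ hz, hS2 _ hz'D, div_left_inj' hlo] at h1
    simpa [sub_eq_zero] using h1
  have hcon : IsPreconnected {m : ℂ | z + m • (z' - z) ∈ D} :=
    (hcc.isSimplyConnected_slice (m := 0)
      (by simpa using hz)).isPathConnected.isConnected.isPreconnected
  have h01 : S (z + (1 : ℂ) • (z' - z)) = S (z + (0 : ℂ) • (z' - z)) := by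
    refine hcon.eq_of_sq_eq (𝕜 := ℂ) (f := fun m : ℂ => S (z + m • (z' - z)))
      (g := fun _ => S (z + (0 : ℂ) • (z' - z))) (hS.comp (by fun_prop) fun m hm => hm)
      continuousOn_const ?_ (fun _ => hne _ (by simpa using hz)) (y := 0) (by simpa using hz) rfl
      (by simpa using hz'D)
    intro m hm
    simp only [Pi.pow_apply]
    rw [hS2 _ hm, hS2 _ (by simpa using hz)]
    have : z + m • (z' - z) - (o + c • X) =
        (z + (0 : ℂ) • (z' - z) - (o + c • X)) + m • (z' - z) := by
      rw [zero_smul, add_zero]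
      abel
    rw [this, map_add l, map_smul, hll, smul_zero, add_zero]
  rw [one_smul, zero_smul, add_zero, add_sub_cancel, hSz'] at h01
  exact hne z hz (neg_eq_self.1 h01)

/-- A Koebe-type estimate: a ℂ-convex open set containing the analytic disc `o + ζ ^ k • ψ ζ`,
`‖ζ‖ ≤ ρ`, contains the disc of radius `ρ ^ k / 36` about `o` in the direction `ψ 0`, provided the
boundary points on that disc have complex supporting hyperplanes. -/
theorem IsCConvex.add_smul_mem_of_disc {n : ℕ} {D : Set (Cn n)} (hcc : IsCConvex D)
    (hDo : IsOpen D) {o : Cn n} {ψ : ℂ → Cn n} {ρ₀ ρ : ℝ} (hρ : 0 < ρ) (hρρ₀ : ρ < ρ₀)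
    (hψ : DifferentiableOn ℂ ψ (ball 0 ρ₀)) {k : ℕ} (hk : k ≠ 0)
    (hD : ∀ ζ : ℂ, ‖ζ‖ ≤ ρ → o + ζ ^ k • ψ ζ ∈ D)
    (hsupp : ∀ m : ℂ, ‖m‖ < ρ ^ k / 36 → o + m • ψ 0 ∈ frontier D →
      ∃ l : Cn n →L[ℂ] ℂ, ∀ z ∈ D, l (z - (o + m • ψ 0)) ≠ 0)
    {m : ℂ} (hm : ‖m‖ < ρ ^ k / 36) : o + m • ψ 0 ∈ D := by
  by_contra hmD
  set X := ψ 0 with hX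
  have hcont : Continuous fun m : ℂ => o + m • X := by fun_prop
  have ho : o ∈ D := by simpa [hk] using hD 0 (by simpa using hρ.le)
  obtain ⟨c, ⟨hcm, hcD⟩, hcmin⟩ := ((isCompact_closedBall (0 : ℂ) ‖m‖).inter_right
    (hDo.preimage hcont).isClosed_compl).exists_isMinOn ⟨m, by simp, hmD⟩
    continuous_norm.continuousOn
  rw [mem_closedBall_zero_iff] at hcm
  have hdisc : ∀ q : ℂ, ‖q‖ < ‖c‖ → o + q • X ∈ D := fun q hq => by
    by_contra hqD
    exact absurd (isMinOn_iff.1 hcmin q ⟨by simpa using hq.le.trans hcm, hqD⟩) (not_le.2 hq)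
  have hc0 : c ≠ 0 := by
    rintro rfl
    exact hcD (by simpa using ho)
  have hcfr : o + c • X ∈ frontier D := by
    rw [hDo.frontier_eq]
    refine ⟨map_mem_closure (f := fun m : ℂ => o + m • X) hcont (s := ball 0 ‖c‖) ?_
      fun q hq => hdisc q (mem_ball_zero_iff.1 hq), hcD⟩
    rw [closure_ball _ (norm_ne_zero_iff.2 hc0)]
    simp
  obtain ⟨l, hl⟩ := hsupp c (hcm.trans_lt hm) hcfr
  obtain ⟨S, hS, hS2, hSo, hS4⟩ := hcc.exists_sqrt_norm_add_one_ge hDo ho hl hdisc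
  have hloX : l (o - (o + c • X)) = -(c * l X) := by simp
  have hlX : l X ≠ 0 := fun h => hl o ho (by rw [hloX, h]; simp)
  -- work on the open set of parameters that are mapped into `D`
  set φ : ℂ → Cn n := fun ζ => o + ζ ^ k • ψ ζ with hφ
  have hφd : DifferentiableOn ℂ φ (ball 0 ρ₀) := by
    have : DifferentiableOn ℂ (fun ζ : ℂ => ζ ^ k) (ball 0 ρ₀) := by fun_prop
    exact (this.smul hψ).const_add o
  set V := ball (0 : ℂ) ρ₀ ∩ φ ⁻¹' D with hVdef
  have hVo : IsOpen V := hφd.continuousOn.isOpen_inter_preimage isOpen_ball hDo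
  have hVρ : closedBall (0 : ℂ) ρ ⊆ V := fun ζ hζ =>
    ⟨closedBall_subset_ball hρρ₀ hζ, hD ζ (mem_closedBall_zero_iff.1 hζ)⟩
  set u : ℂ → ℂ := fun ζ => l (ψ ζ) / l X with hu
  have hψV : DifferentiableOn ℂ ψ V := hψ.mono inter_subset_left
  have hud : DifferentiableOn ℂ u V :=
    ((l.differentiable.comp_differentiableOn hψV).div_const _)
  have hSφ2 : ∀ ζ ∈ V, S (φ ζ) ^ 2 = 1 - ζ ^ k * u ζ / c := fun ζ hζ => by
    rw [hS2 _ hζ.2, hloX]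
    have : l (φ ζ - (o + c • X)) = ζ ^ k * l (ψ ζ) - c * l X := by
      simp only [hφ, map_sub, map_add, map_smul, smul_eq_mul]
      ring
    rw [this, hu]
    field_simp
    ring
  have hSφd : DifferentiableOn ℂ (fun ζ => S (φ ζ)) V := by
    refine differentiableOn_of_continuousOn_of_sq_eq (f := fun ζ => 1 - ζ ^ k * u ζ / c) hVo
      (by fun_prop) (hS.comp (hφd.continuousOn.mono inter_subset_left) fun ζ hζ => hζ.2) hSφ2
      fun ζ hζ => ?_
    rw [← hSφ2 ζ hζ, hS2 _ hζ.2]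
    exact div_ne_zero (hl _ hζ.2) (hl o ho)
  have h1S : ∀ ζ ∈ V, 1 + S (φ ζ) ≠ 0 := fun ζ hζ h => by
    have := hS4 _ hζ.2
    rw [h] at this
    norm_num at this
  set W : ℂ → ℂ := fun ζ => u ζ / (2 * c * (1 + S (φ ζ)) ^ 2) with hW
  have hWd : DifferentiableOn ℂ W V := by
    refine hud.div (((hSφd.const_add 1).pow 2).const_mul (2 * c)) fun ζ hζ => ?_
    exact mul_ne_zero (mul_ne_zero two_ne_zero hc0) (pow_ne_zero _ (h1S ζ hζ))
  have hWk : ∀ ζ ∈ V, ‖ζ ^ k * W ζ‖ ≤ 9 / 2 := fun ζ hζ => by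
    have h1 := h1S ζ hζ
    have : ζ ^ k * W ζ = (1 + S (φ ζ))⁻¹ - 1 / 2 := by
      have h2 : ζ ^ k * u ζ = c * (1 - S (φ ζ) ^ 2) := by
        rw [hSφ2 ζ hζ]
        field_simp
        ring
      rw [hW]
      simp only
      rw [← mul_div_assoc, h2]
      field_simp
      ring
    rw [this]
    refine (norm_sub_le _ _).trans ?_
    have h3 : ‖(1 + S (φ ζ))⁻¹‖ ≤ 4 := by
      rw [norm_inv]
      refine inv_le_of_inv_le₀ (by norm_num) ?_
      have := hS4 _ hζ.2
      linarith
    have h4 : ‖(1 / 2 : ℂ)‖ = 1 / 2 := by norm_num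
    rw [h4]
    linarith
  have hmax : ‖W 0‖ ≤ 9 / 2 / ρ ^ k := by
    refine Complex.norm_le_of_forall_mem_frontier_norm_le (U := ball (0 : ℂ) ρ) isBounded_ball
      ((hWd.mono hVρ).diffContOnCl_ball Subset.rfl) (fun ζ hζ => ?_)
      (subset_closure (mem_ball_self hρ))
    rw [frontier_ball _ hρ.ne'] at hζ
    rw [le_div_iff₀ (by positivity), mul_comm, ← mem_sphere_zero_iff_norm.1 hζ, ← norm_pow,
      ← norm_mul]
    exact hWk ζ (hVρ (sphere_subset_closedBall hζ))
  have hW0 : W 0 = 1 / (8 * c) := by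
    have : φ 0 = o := by simp [hφ, hk]
    simp only [hW, hu, this, hSo, ← hX, div_self hlX]
    norm_num
    ring
  rw [hW0, norm_div, norm_one, norm_mul, Complex.norm_ofNat, le_div_iff₀ (by positivity),
    div_mul_eq_mul_div, one_mul, div_le_iff₀ (by positivity)] at hmax
  linarith

/-- Smooth boundary points of a ℂ-convex open set have complex supporting hyperplanes. -/
theorem IsCConvex.exists_supporting {n : ℕ} {D : Set (Cn n)} (hcc : IsCConvex D)
    (hDo : IsOpen D) {p : Cn n} (hp : p ∉ D) {r : Cn n → ℝ} {L : Cn n →L[ℝ] ℝ}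
    (hr : HasFDerivAt r L p) (hrp : r p = 0) (hrD : ∀ᶠ z in nhds p, r z < 0 → z ∈ D)
    (hL : L ≠ 0) : ∃ l : Cn n →L[ℂ] ℂ, ∀ z ∈ D, l (z - p) ≠ 0 := by
  have hre : ∀ x, (StrongDual.extendRCLike (𝕜 := ℂ) L x).re = L x := fun x =>
    StrongDual.re_extendRCLike_apply (𝕜 := ℂ) L x
  refine ⟨StrongDual.extendRCLike (𝕜 := ℂ) L, fun z hz h => ?_⟩
  refine hcc.add_notMem_of_tangent hDo hp hr hrp hrD hL (Y := z - p) (fun κ => ?_)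
    (by rwa [add_sub_cancel])
  rw [← hre, map_smul, h, smul_zero, Complex.zero_re]

theorem eventually_forall_norm_le {P : ℂ → Prop} (h : ∀ᶠ ζ in nhds 0, P ζ) :
    ∀ᶠ s in nhdsWithin (0 : ℝ) (Ioi 0), ∀ ζ : ℂ, ‖ζ‖ ≤ s → P ζ := by
  obtain ⟨ε, hε, hball⟩ := Metric.eventually_nhds_iff.1 h
  filter_upwards [Ioo_mem_nhdsGT hε] with s hs ζ hζ
  exact hball (by rw [dist_zero_right]; exact hζ.trans_lt hs.2)

/-- If an analytic disc `a + ζ ^ k • ψ ζ` has contact of order `N` with the boundary, then the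
complex line in direction `ψ 0` has contact of order at least `N / k`, from one side. -/
theorem IsCConvex.eventually_line_le_of_disc {n : ℕ} {D : Set (Cn n)} (hcc : IsCConvex D)
    (hDo : IsOpen D) {U : Set (Cn n)} (hU : IsOpen U) {a : Cn n} (haU : a ∈ U) {r : Cn n → ℝ}
    (hr : ContDiffOn ℝ (⊤ : ℕ∞) r U) (hgrad : ∀ x ∈ U, fderiv ℝ r x ≠ 0)
    (hsub : D ∩ U = {x ∈ U | r x < 0}) (hbd : frontier D ∩ U = {x ∈ U | r x = 0})
    {ψ : ℂ → Cn n} (hψ : AnalyticAt ℂ ψ 0) {k N : ℕ} (hk : k ≠ 0) (hN : N ≠ 0)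
    (hO : (fun ζ => r (a + ζ ^ k • ψ ζ)) =O[nhds 0] fun ζ : ℂ => ‖ζ‖ ^ N) :
    ∃ C, ∀ᶠ s in nhdsWithin (0 : ℝ) (Ioi 0), ∀ m : ℂ, ‖m‖ < s ^ k / 36 →
      r (a + m • ψ 0) ≤ C * s ^ N := by
  have hrU : ∀ p ∈ U, ContDiffAt ℝ (⊤ : ℕ∞) r p := fun p hp => hr.contDiffAt (hU.mem_nhds hp)
  have hneg : ∀ z ∈ U, r z < 0 → z ∈ D := fun z hz h => (hsub.ge ⟨hz, h⟩).1
  have hneg' : ∀ z ∈ U, z ∈ D → r z < 0 := fun z hz h => (hsub.le ⟨h, hz⟩).2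
  have hsupp : ∀ p ∈ U, p ∈ frontier D → ∃ l : Cn n →L[ℂ] ℂ, ∀ z ∈ D, l (z - p) ≠ 0 :=
    fun p hpU hp => hcc.exists_supporting hDo (hDo.frontier_eq ▸ hp).2
      ((hrU p hpU).differentiableAt (by simp)).hasFDerivAt (hbd.le ⟨hp, hpU⟩).2
      (by filter_upwards [hU.mem_nhds hpU] with z hz using hneg z hz) (hgrad p hpU)
  set L := fderiv ℝ r a with hLdef
  obtain ⟨ν, hν⟩ : ∃ ν, L ν = 1 := by
    obtain ⟨v, hv⟩ := DFunLike.ne_iff.1 (hgrad a haU)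
    exact ⟨(L v)⁻¹ • v, by rw [map_smul, smul_eq_mul, inv_mul_cancel₀ hv]⟩
  have hstrict : HasStrictFDerivAt r L a := (hrU a haU).hasStrictFDerivAt (by simp)
  obtain ⟨ε, hε, hball⟩ : ∃ ε > 0, ∀ x ∈ ball a ε, x ∈ U ∧ ∀ y ∈ ball a ε,
      ‖r x - r y - L (x - y)‖ ≤ 1 / (2 * (‖ν‖ + 1)) * ‖x - y‖ := by
    have h1 := hstrict.isLittleO.def (c := 1 / (2 * (‖ν‖ + 1))) (by positivity)
    rw [nhds_prod_eq] at h1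
    obtain ⟨pa, hpa, pb, hpb, hab⟩ := Filter.eventually_prod_iff.1 h1
    obtain ⟨ε, hε, hball⟩ := Metric.eventually_nhds_iff_ball.1
      ((hpa.and hpb).and (hU.mem_nhds haU))
    exact ⟨ε, hε, fun x hx => ⟨(hball x hx).2, fun y hy => hab (hball x hx).1.1 (hball y hy).1.2⟩⟩
  have hshift : ∀ z ∈ ball a (ε / 2), ∀ δ > 0, δ * ‖ν‖ < ε / 2 →
      z - (δ : ℂ) • ν ∈ U ∧ r (z - (δ : ℂ) • ν) ≤ r z - δ / 2 ∧
        r z ≤ r (z - (δ : ℂ) • ν) + 3 / 2 * δ := by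
    intro z hz δ hδ hδε
    have hd : ‖z - (δ : ℂ) • ν - z‖ = δ * ‖ν‖ := by
      rw [sub_sub_cancel_left, norm_neg, norm_smul, Complex.norm_real, Real.norm_of_nonneg hδ.le]
    have hz2 : z - (δ : ℂ) • ν ∈ ball a ε := by
      rw [mem_ball] at hz ⊢
      have := dist_triangle (z - (δ : ℂ) • ν) z a
      rw [dist_eq_norm (z - (δ : ℂ) • ν) z, hd] at this
      linarith
    obtain ⟨h1, h2⟩ := hball _ hz2
    have h3 := h2 z (ball_subset_ball (by linarith) hz)
    have hLd : L (z - (δ : ℂ) • ν - z) = -δ := by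
      rw [sub_sub_cancel_left, map_neg, Complex.coe_smul, map_smul, hν, smul_eq_mul, mul_one]
    rw [hd, hLd, Real.norm_eq_abs] at h3
    have h4 : 1 / (2 * (‖ν‖ + 1)) * (δ * ‖ν‖) ≤ δ / 2 := by
      rw [div_mul_eq_mul_div, div_le_div_iff₀ (by positivity) (by positivity)]
      nlinarith
    have h5 := abs_le.1 (h3.trans h4)
    exact ⟨h1, by linarith [h5.2], by linarith [h5.1]⟩
  obtain ⟨C, hC, hCO⟩ := hO.exists_pos
  obtain ⟨R, hR, hψR⟩ := Metric.eventually_nhds_iff_ball.1 hψ.eventually_analyticAt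
  have hψd : DifferentiableOn ℂ ψ (ball 0 R) := fun z hz =>
    (hψR z hz).differentiableAt.differentiableWithinAt
  have hdisc : ∀ᶠ ζ in nhds (0 : ℂ), a + ζ ^ k • ψ ζ ∈ ball a (ε / 2) := by
    have hc : ContinuousAt (fun ζ : ℂ => a + ζ ^ k • ψ ζ) 0 :=
      continuousAt_const.add ((continuous_pow k).continuousAt.smul hψ.continuousAt)
    exact hc.eventually_mem (by simpa [hk] using ball_mem_nhds a (half_pos hε))
  have hline : ∀ᶠ m in nhds (0 : ℂ), a + m • ψ 0 ∈ ball a (ε / 2) := by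
    have hc : ContinuousAt (fun m : ℂ => a + m • ψ 0) 0 := by fun_prop
    exact hc.eventually_mem (by simpa using ball_mem_nhds a (half_pos hε))
  have htendsk : Filter.Tendsto (fun s : ℝ => s ^ k / 36) (nhdsWithin 0 (Ioi 0))
      (nhdsWithin 0 (Ioi 0)) := by
    refine tendsto_nhdsWithin_iff.2 ⟨?_, ?_⟩
    · have : Continuous fun s : ℝ => s ^ k / 36 := by fun_prop
      simpa [hk] using (this.tendsto 0).mono_left nhdsWithin_le_nhds
    · filter_upwards [self_mem_nhdsWithin] with s hs
      have : (0 : ℝ) < s := hs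
      exact mem_Ioi.2 (by positivity)
  have hsmall : ∀ᶠ s in nhdsWithin (0 : ℝ) (Ioi 0), 4 * C * s ^ N * ‖ν‖ < ε / 2 := by
    have hc : Continuous fun s : ℝ => 4 * C * s ^ N * ‖ν‖ := by fun_prop
    exact nhdsWithin_le_nhds (hc.continuousAt.eventually_lt continuousAt_const
      (by simpa [hN] using hε))
  refine ⟨6 * C, ?_⟩
  filter_upwards [eventually_forall_norm_le hCO.bound, eventually_forall_norm_le hdisc,
    htendsk.eventually (eventually_forall_norm_le hline), hsmall, Ioo_mem_nhdsGT hR]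
    with s hs1 hs2 hs3 hs4 hs5 m hm
  have hs0 : 0 < s := hs5.1
  set δ := 4 * C * s ^ N with hδ
  have hδ0 : 0 < δ := by positivity
  have hcomm : ∀ v, a - (δ : ℂ) • ν + v = a + v - (δ : ℂ) • ν := fun v => by abel
  have hmem : a - (δ : ℂ) • ν + m • ψ 0 ∈ D := by
    refine hcc.add_smul_mem_of_disc hDo hs0 hs5.2 hψd hk (fun ζ hζ => ?_) (fun q hq hqf => ?_) hm
    · rw [hcomm]
      obtain ⟨h1, h2, -⟩ := hshift _ (hs2 ζ hζ) δ hδ0 hs4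
      refine hneg _ h1 (h2.trans_lt ?_)
      have h3 := hs1 ζ hζ
      rw [norm_pow, norm_norm] at h3
      have h4 : r (a + ζ ^ k • ψ ζ) ≤ C * s ^ N :=
        (le_abs_self _).trans (h3.trans (by gcongr))
      have : 0 < C * s ^ N := by positivity
      rw [hδ]
      linarith
    · rw [hcomm] at hqf ⊢
      exact hsupp _ (hshift _ (hs3 q hq.le) δ hδ0 hs4).1 hqf
  rw [hcomm] at hmem
  obtain ⟨h1, -, h2⟩ := hshift _ (hs3 m hm.le) δ hδ0 hs4
  have := hneg' _ h1 hmem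
  rw [hδ] at h2
  linarith

theorem HasDerivAt.nonpos_of_eventually_le {g : ℝ → ℝ} {g' : ℝ} (hg : HasDerivAt g g' 0)
    (h0 : g 0 = 0) (h : ∀ ε > 0, ∀ᶠ t in nhds 0, g t ≤ ε * ‖t‖) : g' ≤ 0 := by
  refine le_of_forall_pos_le_add fun ε hε => ?_
  rw [zero_add]
  refine le_of_tendsto ((hasDerivAt_iff_tendsto_slope_zero.1 hg).mono_left
    (nhdsWithin_mono 0 (s := Ioi 0) fun t ht => ne_of_gt ht)) ?_
  filter_upwards [self_mem_nhdsWithin, nhdsWithin_le_nhds (h ε hε)] with t ht hle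
  have ht' : (0 : ℝ) < t := ht
  rw [Real.norm_of_nonneg ht'.le] at hle
  rw [zero_add, h0, sub_zero, smul_eq_mul, inv_mul_le_iff₀ ht', mul_comm]
  exact hle

theorem eventually_le_mul_norm_pow_of_forall_norm_lt {g : ℂ → ℝ} (h0 : g 0 = 0) {k : ℕ}
    (hk : k ≠ 0) (j : ℕ) {C : ℝ} (h : ∀ᶠ s in nhdsWithin (0 : ℝ) (Ioi 0),
      ∀ m : ℂ, ‖m‖ < s ^ k / 36 → g m ≤ C * s ^ (j * k + 1)) {ε : ℝ} (hε : 0 < ε) :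
    ∀ᶠ m in nhds (0 : ℂ), g m ≤ ε * ‖m‖ ^ j := by
  have hev : ∀ᶠ s in nhdsWithin (0 : ℝ) (Ioi 0), C * 72 ^ j * s < ε := by
    have hc : Continuous fun s : ℝ => C * 72 ^ j * s := by fun_prop
    exact nhdsWithin_le_nhds (hc.continuousAt.eventually_lt continuousAt_const (by simpa using hε))
  have htends : Filter.Tendsto (fun m : ℂ => (72 * ‖m‖) ^ (1 / k : ℝ)) (nhdsWithin 0 {0}ᶜ)
      (nhdsWithin 0 (Ioi 0)) := by
    refine tendsto_nhdsWithin_iff.2 ⟨?_, ?_⟩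
    · have hc : Continuous fun m : ℂ => (72 * ‖m‖) ^ (1 / k : ℝ) :=
        Continuous.rpow_const (by fun_prop) fun _ => Or.inr (by positivity)
      have := (hc.tendsto 0).mono_left (nhdsWithin_le_nhds (s := {0}ᶜ))
      simpa [Real.zero_rpow, hk] using this
    · filter_upwards [self_mem_nhdsWithin] with m hm
      have : 0 < ‖m‖ := norm_pos_iff.2 hm
      exact mem_Ioi.2 (by positivity)
  have hpunct := eventually_nhdsWithin_iff.1 (htends.eventually (h.and hev))
  filter_upwards [hpunct] with m hm
  rcases eq_or_ne m 0 with rfl | hm0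
  · rw [h0]
    positivity
  obtain ⟨h1, h2⟩ := hm hm0
  have hmp : 0 < ‖m‖ := norm_pos_iff.2 hm0
  set s := (72 * ‖m‖) ^ (1 / k : ℝ) with hs
  have hsk : s ^ k = 72 * ‖m‖ := by
    rw [hs, one_div, Real.rpow_inv_natCast_pow (by positivity) hk]
  refine (h1 m (by rw [hsk]; linarith)).trans ?_
  rw [pow_succ, mul_comm j, pow_mul, hsk, mul_pow]
  calc C * (72 ^ j * ‖m‖ ^ j * s) = C * 72 ^ j * s * ‖m‖ ^ j := by ring
    _ ≤ ε * ‖m‖ ^ j := by gcongr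

/-- At a smooth boundary point of a ℂ-convex open set, if all derivatives of order at most `j * k`
vanish along the disc `a + ζ ^ k • ψ ζ`, then the derivative of order `j` vanishes along the
complex line in direction `ψ 0`. -/
theorem IsCConvex.iteratedFDeriv_line_eq_zero {n : ℕ} {D : Set (Cn n)} (hcc : IsCConvex D)
    (hDo : IsOpen D) {U : Set (Cn n)} (hU : IsOpen U) {a : Cn n} (ha : a ∈ frontier D)
    (haU : a ∈ U) {r : Cn n → ℝ}
    (hr : ContDiffOn ℝ (⊤ : ℕ∞) r U) (hgrad : ∀ x ∈ U, fderiv ℝ r x ≠ 0)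
    (hsub : D ∩ U = {x ∈ U | r x < 0}) (hbd : frontier D ∩ U = {x ∈ U | r x = 0})
    {ψ : ℂ → Cn n} (hψ : AnalyticAt ℂ ψ 0) {k j : ℕ} (hk : k ≠ 0) (hj : j ≠ 0)
    (hO : (fun ζ => r (a + ζ ^ k • ψ ζ)) =O[nhds 0] fun ζ : ℂ => ‖ζ‖ ^ (j * k + 1)) :
    iteratedFDeriv ℝ j (fun m : ℂ => r (a + m • ψ 0)) 0 = 0 := by
  have hra : r a = 0 := (hbd.le ⟨ha, haU⟩).2
  have hrsm : ContDiffAt ℝ (⊤ : ℕ∞) r a := hr.contDiffAt (hU.mem_nhds haU)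
  have hrL : HasFDerivAt r (fderiv ℝ r a) a := (hrsm.differentiableAt (by simp)).hasFDerivAt
  obtain ⟨C, hest⟩ := hcc.eventually_line_le_of_disc hDo hU haU hr hgrad hsub hbd hψ hk
    (Nat.succ_ne_zero _) hO
  have hle : ∀ ε > 0, ∀ᶠ m in nhds (0 : ℂ), r (a + m • ψ 0) ≤ ε * ‖m‖ ^ j := fun ε hε =>
    eventually_le_mul_norm_pow_of_forall_norm_lt (g := fun m : ℂ => r (a + m • ψ 0))
      (by simpa using hra) hk j hest hε
  have hLle : ∀ κ : ℂ, fderiv ℝ r a (κ • ψ 0) ≤ 0 := by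
    intro κ
    have hd : HasDerivAt (fun t : ℝ => r (a + t • κ • ψ 0)) (fderiv ℝ r a (κ • ψ 0)) 0 := by
      have h1 : HasDerivAt (fun t : ℝ => a + t • κ • ψ 0) (κ • ψ 0) 0 := by
        simpa using ((hasDerivAt_id (0 : ℝ)).smul_const (κ • ψ 0)).const_add a
      refine HasFDerivAt.comp_hasDerivAt (l := r) 0 ?_ h1
      simpa using hrL
    refine hd.nonpos_of_eventually_le (by simpa using hra) fun ε hε => ?_
    have hε' : 0 < ε / (‖κ‖ + 1) := by positivity
    have hc : Filter.Tendsto (fun t : ℝ => (t : ℂ) * κ) (nhds 0) (nhds 0) := by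
      have : Continuous fun t : ℝ => (t : ℂ) * κ := by fun_prop
      simpa using this.tendsto 0
    filter_upwards [hc.eventually (hle _ hε'), hc.eventually (ball_mem_nhds 0 one_pos)]
      with t ht ht1
    rw [mul_smul, Complex.coe_smul] at ht
    refine ht.trans ?_
    have h2 : ‖(t : ℂ) * κ‖ ^ j ≤ ‖(t : ℂ) * κ‖ :=
      pow_le_of_le_one (norm_nonneg _) (mem_ball_zero_iff.1 ht1).le hj
    calc ε / (‖κ‖ + 1) * ‖(t : ℂ) * κ‖ ^ j ≤ ε / (‖κ‖ + 1) * ‖(t : ℂ) * κ‖ := by gcongr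
      _ ≤ ε * ‖t‖ := by
        rw [norm_mul, Complex.norm_real, div_mul_eq_mul_div, div_le_iff₀ (by positivity)]
        have : 0 ≤ ε * ‖t‖ := by positivity
        nlinarith
  have hL0 : ∀ κ : ℂ, fderiv ℝ r a (κ • ψ 0) = 0 := fun κ => by
    have h1 := hLle (-κ)
    rw [neg_smul, map_neg] at h1
    exact le_antisymm (hLle κ) (by linarith)
  have haD : a ∉ D := (hDo.frontier_eq ▸ ha).2
  have hnotD : ∀ m : ℂ, a + m • ψ 0 ∉ D := fun m =>
    hcc.add_notMem_of_tangent hDo haD hrL hra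
      (by filter_upwards [hU.mem_nhds haU] with z hz h using (hsub.ge ⟨hz, h⟩).1) (hgrad a haU)
      fun κ => by rw [smul_smul, hL0]
  have hlineU : ∀ᶠ m in nhds (0 : ℂ), a + m • ψ 0 ∈ U := by
    have hc : ContinuousAt (fun m : ℂ => a + m • ψ 0) 0 := by fun_prop
    exact hc.eventually_mem (by simpa using hU.mem_nhds haU)
  refine iteratedFDeriv_eq_zero_of_isLittleO j ?_ (Asymptotics.isLittleO_iff.2 fun ε hε => ?_)
  · refine ContDiffAt.comp (g := r) (f := fun m : ℂ => a + m • ψ 0) 0 ?_ (by fun_prop)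
    simpa using hrsm.of_le (by exact_mod_cast le_top)
  · filter_upwards [hle ε hε, hlineU] with m hm hmU
    have h0 : 0 ≤ r (a + m • ψ 0) := by
      by_contra! h
      exact hnotD m (hsub.ge ⟨hmU, h⟩).1
    rwa [Real.norm_of_nonneg h0, norm_pow, norm_norm]

theorem ordV_eq_of_analyticOrderAt_eq {n : ℕ} {f : ℂ → Cn n} (hf : AnalyticAt ℂ f 0) {k : ℕ}
    (hk : analyticOrderAt f 0 = k) : ordV f = k := by
  obtain ⟨h1, h2⟩ := (analyticOrderAt_eq_nat_iff_iteratedDeriv_eq_zero hf).1 hk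
  refine le_antisymm (sInf_le ⟨k, rfl, h2⟩) (le_sInf ?_)
  rintro _ ⟨m, rfl, hm⟩
  by_contra! h
  exact hm (h1 m (by exact_mod_cast h))

theorem ordV_line {n : ℕ} (a : Cn n) {X : Cn n} (hX : X ≠ 0) :
    ordV (fun w : ℂ => a + w • X - a) = 1 := by
  have hf : AnalyticAt ℂ (fun w : ℂ => a + w • X - a) 0 := by fun_prop
  have := ordV_eq_of_analyticOrderAt_eq hf (k := 1)
    (hf.analyticOrderAt_eq_natCast.2 ⟨fun _ => X, analyticAt_const, hX, by simp⟩)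
  simpa using this

/-- The order of contact of an analytic disc is at most that of a suitable complex line. -/
theorem IsCConvex.exists_line_ordR_ge {n : ℕ} {D : Set (Cn n)} (hcc : IsCConvex D)
    (hDo : IsOpen D) {U : Set (Cn n)} (hU : IsOpen U) {a : Cn n} (ha : a ∈ frontier D)
    (haU : a ∈ U) {r : Cn n → ℝ}
    (hr : ContDiffOn ℝ (⊤ : ℕ∞) r U) (hgrad : ∀ x ∈ U, fderiv ℝ r x ≠ 0)
    (hsub : D ∩ U = {x ∈ U | r x < 0}) (hbd : frontier D ∩ U = {x ∈ U | r x = 0})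
    {φ : ℂ → Cn n} (hφ : DifferentiableOn ℂ φ (ball 0 1)) (hφ0 : φ 0 = a)
    (hφne : ∃ w ∈ ball (0 : ℂ) 1, φ w ≠ a) :
    ∃ X : Cn n, X ≠ 0 ∧ ordR (fun w => r (φ w)) / ordV (fun w => φ w - a) ≤
      ordR (fun w : ℂ => r (a + w • X)) := by
  have hφa : AnalyticOnNhd ℂ (fun w => φ w - a) (ball 0 1) :=
    (hφ.sub_const a).analyticOnNhd isOpen_ball
  have hφa0 : AnalyticAt ℂ (fun w => φ w - a) 0 := hφa 0 (mem_ball_self one_pos)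
  have htop : analyticOrderAt (fun w => φ w - a) 0 ≠ ⊤ := by
    intro h
    obtain ⟨w, hw, hwa⟩ := hφne
    have := hφa.eqOn_zero_of_preconnected_of_eventuallyEq_zero (convex_ball _ _).isPreconnected
      (mem_ball_self one_pos) (analyticOrderAt_eq_top.1 h) hw
    exact hwa (sub_eq_zero.1 this)
  obtain ⟨k, hk⟩ := ENat.ne_top_iff_exists.1 htop
  obtain ⟨ψ, hψ, hψ0, hφψ⟩ := hφa0.analyticOrderAt_eq_natCast.1 hk.symm
  have hk0 : k ≠ 0 := by
    rintro rfl
    exact (hφa0.analyticOrderAt_eq_zero.1 hk.symm) (by simp [hφ0])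
  have hra : r a = 0 := (hbd.le ⟨ha, haU⟩).2
  have hrsm : ContDiffAt ℝ (⊤ : ℕ∞) r a := hr.contDiffAt (hU.mem_nhds haU)
  refine ⟨ψ 0, hψ0, ?_⟩
  rw [ordV_eq_of_analyticOrderAt_eq hφa0 hk.symm]
  refine le_sInf ?_
  rintro _ ⟨j, rfl, hj⟩
  rw [ENNReal.div_le_iff (by exact_mod_cast hk0) (ENNReal.natCast_ne_top k)]
  by_contra! hlt
  have hvan : ∀ m < j * k + 1, iteratedFDeriv ℝ m (fun w => r (φ w)) 0 = 0 := by
    intro m hm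
    by_contra hne
    refine absurd (sInf_le ⟨m, rfl, hne⟩ : ordR (fun w => r (φ w)) ≤ m)
      (not_le.2 (lt_of_le_of_lt ?_ hlt))
    exact_mod_cast Nat.lt_succ_iff.1 hm
  have hφsm : ContDiffAt ℝ (⊤ : ℕ∞) φ 0 :=
    ((hφ.analyticOnNhd isOpen_ball 0 (mem_ball_self one_pos)).contDiffAt).restrict_scalars ℝ
  have hsm : ContDiffAt ℝ (j * k + 1 : ℕ) (fun w => r (φ w)) 0 := by
    refine (ContDiffAt.comp (g := r) (f := φ) (n := (⊤ : ℕ∞)) 0 (by rwa [hφ0]) hφsm).of_le ?_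
    exact_mod_cast le_top
  have hO := isBigO_pow_of_iteratedFDeriv_eq_zero (j * k + 1) hsm hvan
  refine hj (hcc.iteratedFDeriv_line_eq_zero hDo hU ha haU hr hgrad hsub hbd hψ hk0 ?_
    (hO.congr' ?_ Filter.EventuallyEq.rfl))
  · rintro rfl
    apply hj
    ext
    simp [hra]
  · filter_upwards [hφψ] with ζ hζ
    rw [sub_zero] at hζ
    rw [← hζ, add_sub_cancel]

/-- For a smooth boundary point `a` of a ℂ-convex domain `D`, the type
`m_a` (sup over nonconstant analytic discs `φ` through `a` of `ord₀(r∘φ)/ord₀(φ - a)`)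
equals the line type `l_a` (sup over directions `X ≠ 0` of `ord₀(λ ↦ r(a + λX))`). -/
theorem statement7 {n : ℕ} (D : Set (Cn n)) (hD : IsDomain' D) (hcc : IsCConvex D)
    (a : Cn n) (ha : a ∈ frontier D)
    (U : Set (Cn n)) (hU : IsOpen U) (haU : a ∈ U) (r : Cn n → ℝ)
    (hr : ContDiffOn ℝ (⊤ : ℕ∞) r U) (hgrad : ∀ x ∈ U, fderiv ℝ r x ≠ 0)
    (hsub : D ∩ U = {x ∈ U | r x < 0})
    (hbd : frontier D ∩ U = {x ∈ U | r x = 0}) :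
    (⨆ φ ∈ {φ : ℂ → Cn n | DifferentiableOn ℂ φ (Metric.ball (0:ℂ) 1) ∧ φ 0 = a ∧
        ∃ w ∈ Metric.ball (0:ℂ) 1, φ w ≠ a},
      ordR (fun w => r (φ w)) / ordV (fun w => φ w - a)) =
    ⨆ (X : Cn n) (_ : X ≠ 0), ordR (fun w : ℂ => r (a + w • X)) := by
  refine le_antisymm (iSup₂_le ?_) (iSup₂_le fun X hX => ?_)
  · rintro φ ⟨hφ, hφ0, hφne⟩
    obtain ⟨X, hX, hle⟩ := hcc.exists_line_ordR_ge hD.1 hU ha haU hr hgrad hsub hbd hφ hφ0 hφne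
    exact hle.trans (le_iSup₂_of_le X hX le_rfl)
  · refine le_iSup₂_of_le (fun w : ℂ => a + w • X)
      ⟨by fun_prop, by simp, 1 / 2, by norm_num [mem_ball_zero_iff], by simpa using hX⟩ ?_
    rw [ordV_line a hX, div_one]

end
end

section
/- Let G ⊆ ℂ^n be a weakly linearly convex domain which contains, for each j = 1,…,n, the unit disc 𝔻_j = {λ e_j : |λ| < 1} in the j-th complex coordinate line. Then G contains the convex hull of the union of these discs, i.e. E := {z ∈ ℂ^n : Σ_{j=1}^n |z_j| < 1} ⊆ G. -/
open Complex Metric Set MeasureTheory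

noncomputable section

/-- A weakly linearly convex domain `G ⊆ ℂⁿ` containing the unit disc
in each complex coordinate axis contains `E = {z : Σ_j |z_j| < 1}`. -/
theorem statement9 {n : ℕ} (G : Set (Cn n)) (hG : IsDomain' G) (hwlc : WeaklyLinConvex G)
    (hdiscs : ∀ j : Fin n, ∀ l : ℂ, ‖l‖ < 1 → l • (EuclideanSpace.single j (1:ℂ)) ∈ G) :
    {z : Cn n | ∑ j, ‖z j‖ < 1} ⊆ G := by
  obtain ⟨hopen, hconn⟩ := hG
  have h0 : (0 : Cn n) ∈ G := by
    rcases isEmpty_or_nonempty (Fin n) with hn | ⟨⟨j⟩⟩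
    · obtain ⟨x, hx⟩ := hconn.nonempty
      rwa [Subsingleton.elim 0 x]
    · simpa using hdiscs j 0 (by simp)
  have hconv : Convex ℝ {z : Cn n | ∑ j, ‖z j‖ < 1} := by
    intro x hx y hy s t hs ht hst
    simp only [mem_ofPred_eq] at hx hy ⊢
    have hle : ∑ j, ‖(s • x + t • y) j‖ ≤ s * ∑ j, ‖x j‖ + t * ∑ j, ‖y j‖ := by
      rw [Finset.mul_sum, Finset.mul_sum, ← Finset.sum_add_distrib]
      refine Finset.sum_le_sum fun j _ => ?_
      refine (norm_add_le _ _).trans_eq ?_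
      simp [abs_of_nonneg hs, abs_of_nonneg ht]
    have hlt := (convex_Iio (1 : ℝ)) hx hy hs ht hst
    exact hle.trans_lt hlt
  refine hconv.isPreconnected.subset_of_closure_inter_subset hopen ⟨0, by simp, h0⟩ ?_
  rintro b ⟨hbG, hb⟩
  by_contra hbn
  obtain ⟨ℓ, -, hℓ⟩ := hwlc b (hopen.frontier_eq ▸ ⟨hbG, hbn⟩)
  have hc : 0 < ‖ℓ b‖ := norm_pos_iff.mpr fun h => hℓ 0 h0 (by rw [map_zero, h])
  have hcoord : ∀ j, ‖ℓ (EuclideanSpace.single j 1)‖ ≤ ‖ℓ b‖ := by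
    intro j
    by_contra! hlt
    have hpos := hc.trans hlt
    refine hℓ _ (hdiscs j (ℓ b / ℓ (EuclideanSpace.single j 1)) ?_) ?_
    · rwa [norm_div, div_lt_one hpos]
    · rw [map_smul, smul_eq_mul, div_mul_cancel₀ _ (norm_pos_iff.mp hpos)]
  have hexp : ℓ b = ∑ j, b j * ℓ (EuclideanSpace.single j 1) := by
    conv_lhs => rw [← (EuclideanSpace.basisFun (Fin n) ℂ).sum_repr b]
    simp
  have hle : ‖ℓ b‖ ≤ (∑ j, ‖b j‖) * ‖ℓ b‖ := by
    conv_lhs => rw [hexp]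
    rw [Finset.sum_mul]
    refine (norm_sum_le _ _).trans (Finset.sum_le_sum fun j _ => ?_)
    rw [norm_mul]
    gcongr
    exact hcoord j
  exact hle.not_gt ((mul_lt_iff_lt_one_left hc).mpr hb)

end
end

section
/- Let G ⊆ ℂ^n be a weakly linearly convex domain and let B ⊆ G be a balanced domain (i.e. λz ∈ B whenever z ∈ B and |λ| ≤ 1). Then G contains the convex hull of B. In particular, the maximal balanced domain contained in G is convex. -/
open Complex Metric Set MeasureTheory

noncomputable section

/-- A linear functional that omits the value `c` on a balanced set has modulus less than `‖c‖`
on the convex hull of that set. -/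
theorem Balanced.norm_lt_of_mem_convexHull {E : Type*} [NormedAddCommGroup E] [NormedSpace ℂ E]
    {B : Set E} (hB : Balanced ℂ B) (f : E →L[ℂ] ℂ) {c : ℂ} (hc : ∀ z ∈ B, f z ≠ c)
    {x : E} (hx : x ∈ convexHull ℝ B) : ‖f x‖ < ‖c‖ := by
  have hconv : Convex ℝ {z : E | ‖f z‖ < ‖c‖} := by
    have h := (convex_ball (0 : ℂ) ‖c‖).linear_preimage (f.restrictScalars ℝ).toLinearMap
    simpa [Set.preimage, Metric.ball, dist_zero_right] using h
  refine convexHull_min (fun z hz => ?_) hconv hx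
  by_contra! hlt
  have hle : ‖c‖ ≤ ‖f z‖ := not_lt.mp hlt
  rcases eq_or_ne (f z) 0 with h0 | h0
  · rw [h0, norm_zero] at hle
    exact hc z hz (by rw [h0, norm_le_zero_iff.mp hle])
  · refine hc ((c / f z) • z) (hB.smul_mem ?_ hz) ?_
    · rw [norm_div]
      exact div_le_one_of_le₀ hle (norm_nonneg _)
    · simp [h0]

/-- The real convex hull of a balanced set in a complex vector space is balanced. -/
theorem Balanced.convexHull_real {E : Type*} [AddCommGroup E] [Module ℂ E]
    {B : Set E} (hB : Balanced ℂ B) : Balanced ℂ (convexHull ℝ B) := by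
  rintro c hc _ ⟨x, hx, rfl⟩
  have hconv : Convex ℝ {z | c • z ∈ convexHull ℝ B} :=
    (convex_convexHull ℝ B).linear_preimage ((LinearMap.lsmul ℂ E c).restrictScalars ℝ)
  exact convexHull_min (t := {z | c • z ∈ convexHull ℝ B})
    (fun z hz => subset_convexHull ℝ B (hB.smul_mem hc hz)) hconv hx

/-- A preconnected set that meets both a set and its complement meets the frontier of that set. -/
theorem IsPreconnected.exists_mem_frontier {X : Type*} [TopologicalSpace X] {s t : Set X}
    (hs : IsPreconnected s) (hst : (s ∩ t).Nonempty) (hst' : (s ∩ tᶜ).Nonempty) :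
    (s ∩ frontier t).Nonempty := by
  by_contra hempty
  have hint : ∀ y ∈ s, y ∈ closure t → y ∈ interior t := fun y hy hyc => by
    by_contra hyi
    exact hempty ⟨y, hy, hyc, hyi⟩
  obtain ⟨y, hy, hyt⟩ := hst
  obtain ⟨z, hz, hzt⟩ := hst'
  obtain ⟨w, -, hwi, hwc⟩ := hs (interior t) (closure t)ᶜ isOpen_interior
    isClosed_closure.isOpen_compl
    (fun w hw => (em (w ∈ closure t)).imp (hint w hw) id)
    ⟨y, hy, hint y hy (subset_closure hyt)⟩
    ⟨z, hz, fun hzc => hzt (interior_subset (hint z hz hzc))⟩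
  exact hwc (subset_closure (interior_subset hwi))

/-- A weakly linearly convex set contains the convex hull of each of its nonempty balanced
subsets. -/
theorem WeaklyLinConvex.convexHull_subset {n : ℕ} {G B : Set (Cn n)} (hG : WeaklyLinConvex G)
    (hne : B.Nonempty) (hB : Balanced ℂ B) (hBG : B ⊆ G) : convexHull ℝ B ⊆ G := by
  intro x hx
  by_contra hxG
  obtain ⟨b, hb⟩ := hne
  have hbH := subset_convexHull ℝ B hb
  obtain ⟨a, haH, haG⟩ := (convex_convexHull ℝ B).isPreconnected.exists_mem_frontier
    ⟨b, hbH, hBG hb⟩ ⟨x, hx, hxG⟩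
  obtain ⟨f, -, hf⟩ := hG a haG
  exact lt_irrefl _ (hB.norm_lt_of_mem_convexHull f (fun z hz => hf z (hBG hz)) haH)

/-- A weakly linearly convex domain `G` contains the convex hull of any
balanced domain `B ⊆ G`; in particular the maximal balanced domain contained in `G`
is convex. -/
theorem statement10 {n : ℕ} (G : Set (Cn n)) (hG : IsDomain' G) (hwlc : WeaklyLinConvex G)
    (B : Set (Cn n)) (hBo : IsOpen B) (hBne : B.Nonempty) (hbal : Balanced ℂ B)
    (hBG : B ⊆ G) :
    convexHull ℝ B ⊆ G ∧
      Convex ℝ (⋃₀ {B' : Set (Cn n) | IsOpen B' ∧ Balanced ℂ B' ∧ B' ⊆ G}) := by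
  refine ⟨hwlc.convexHull_subset hBne hbal hBG, ?_⟩
  set U := ⋃₀ {B' : Set (Cn n) | IsOpen B' ∧ Balanced ℂ B' ∧ B' ⊆ G}
  have hUo : IsOpen U := isOpen_sUnion fun _ h => h.1
  have hUb : Balanced ℂ U := by
    rintro c hc _ ⟨z, ⟨V, hV, hz⟩, rfl⟩
    exact ⟨V, hV, hV.2.1.smul_mem hc hz⟩
  have hUG : U ⊆ G := sUnion_subset fun _ h => h.2.2
  have hUne : U.Nonempty := hBne.mono (subset_sUnion_of_mem ⟨hBo, hbal, hBG⟩)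
  have hsub : convexHull ℝ U ⊆ U := subset_sUnion_of_mem
    ⟨hUo.convexHull, hUb.convexHull_real, hwlc.convexHull_subset hUne hUb hUG⟩
  rw [← hsub.antisymm (subset_convexHull ℝ U)]
  exact convex_convexHull ℝ U

end
end
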